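/- Let R be a finite commutative halidon ring with index m and let G be a cyclic group of order m. Then the number of idempotent elements of the group ring RG equals the number of idempotent elements of R raised to the power |G| = m; that is, |E(RG)| = |E(R)|^m, where E(−) denotes the set of idempotents. -/

import Mathlib

def IsPrimitiveHalidonRoot {R : Type*} [CommRing R] (m : ℕ) (ω : R) : Prop :=
  ω ^ m = 1 ∧ (∀ k : ℕ, 0 < k → k < m → ω ^ k ≠ 1) ∧
    ∀ k : ℕ, 0 < k → k < m → ∑ r ∈ Finset.range m, ω ^ (r * k) = 0

def IsHalidonRing (R : Type*) [CommRing R] (m : ℕ) : Prop :=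
  IsUnit (m : R) ∧ ∃ ω : R, IsPrimitiveHalidonRoot m ω

open Finset

/-- The discrete Fourier transform of a group ring along the powers of a character `χ`. -/
noncomputable def MonoidAlgebra.fourier {R G : Type*} [CommRing R] [Group G] (m : ℕ)
    (χ : G →* R) : MonoidAlgebra R G →ₐ[R] (Fin m → R) :=
  AlgHom.pi fun i ↦ MonoidAlgebra.lift R R G (χ ^ (i : ℕ))

theorem MonoidAlgebra.fourier_apply {R G : Type*} [CommRing R] [Group G] [Fintype G] (m : ℕ)
    (χ : G →* R) (x : MonoidAlgebra R G) (i : Fin m) :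
    fourier m χ x i = ∑ h, x.coeff h * χ h ^ (i : ℕ) := by
  simp [fourier, MonoidAlgebra.lift_apply, Finsupp.sum_fintype]

/-- Fourier inversion, up to the factor `m`. -/
theorem MonoidAlgebra.sum_fourier_mul {R G : Type*} [CommRing R] [Group G] [Fintype G] (m : ℕ)
    (χ : G →* R) (hχ : ∀ h, h ≠ 1 → ∑ i : Fin m, χ h ^ (i : ℕ) = 0)
    (x : MonoidAlgebra R G) (g : G) :
    ∑ i, fourier m χ x i * χ g⁻¹ ^ (i : ℕ) = m * x.coeff g := by
  have key (h : G) : ∑ i : Fin m, x.coeff h * χ h ^ (i : ℕ) * χ g⁻¹ ^ (i : ℕ) =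
      x.coeff h * ∑ i : Fin m, χ (h * g⁻¹) ^ (i : ℕ) := by
    simp only [map_mul, mul_pow, mul_sum, mul_assoc]
  simp only [fourier_apply, sum_mul]
  rw [sum_comm, sum_congr rfl fun h _ ↦ key h, sum_eq_single g]
  · simp [mul_comm]
  · intro h _ hne
    rw [hχ _ (by rwa [ne_eq, mul_inv_eq_one]), mul_zero]
  · simp

theorem MonoidAlgebra.fourier_injective {R G : Type*} [CommRing R] [Group G] [Fintype G] (m : ℕ)
    (hm : IsUnit (m : R)) (χ : G →* R) (hχ : ∀ h, h ≠ 1 → ∑ i : Fin m, χ h ^ (i : ℕ) = 0) :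
    Function.Injective (fourier m χ) := by
  intro x y hxy
  ext g
  apply hm.mul_left_cancel
  rw [← sum_fourier_mul m χ hχ, ← sum_fourier_mul m χ hχ, hxy]

/-- A primitive root of unity defines a character of a cyclic group whose power sums vanish
away from the identity. -/
theorem IsPrimitiveHalidonRoot.exists_character {R G : Type*} [CommRing R] [Group G] [Fintype G]
    [IsCyclic G] {ω : R} (hω : IsPrimitiveHalidonRoot (Fintype.card G) ω) :
    ∃ χ : G →* R, ∀ h, h ≠ 1 → ∑ i : Fin (Fintype.card G), χ h ^ (i : ℕ) = 0 := by
  classical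
  obtain ⟨hpow, -, hsum⟩ := hω
  obtain ⟨g, hg⟩ := IsCyclic.exists_generator (α := G)
  have hord : orderOf g = Fintype.card G := by
    rw [orderOf_eq_card_of_forall_mem_zpowers hg, Nat.card_eq_fintype_card]
  let u : Rˣ := Units.ofPowEqOne ω (Fintype.card G) hpow Fintype.card_ne_zero
  have hu : orderOf u ∣ orderOf g := by
    rw [hord]
    exact orderOf_dvd_of_pow_eq_one (Units.pow_ofPowEqOne hpow Fintype.card_ne_zero)
  refine ⟨(Units.coeHom R).comp (monoidHomOfForallMemZpowers hg hu), fun h hh ↦ ?_⟩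
  obtain ⟨k, hk, rfl⟩ := mem_image.mp (mem_zpowers_iff_mem_range_orderOf.mp (hg h))
  have hk0 : 0 < k := Nat.pos_of_ne_zero fun h0 ↦ hh (by simp [h0])
  rw [← hsum k hk0 (by simpa [hord] using hk), ← Fin.sum_univ_eq_sum_range fun r ↦ ω ^ (r * k)]
  refine sum_congr rfl fun i _ ↦ ?_
  rw [map_pow, ← pow_mul, mul_comm]
  simp [monoidHomOfForallMemZpowers_apply_gen, u]

/-- Idempotents of a power of a ring are families of idempotents. -/
theorem Nat.card_idempotents_pi (R : Type*) [Mul R] (m : ℕ) :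
    Nat.card {x : Fin m → R // x * x = x} = Nat.card {x : R // x * x = x} ^ m := by
  have e : {x : Fin m → R // x * x = x} ≃ (Fin m → {x : R // x * x = x}) :=
    (Equiv.subtypeEquivRight fun x ↦ by simp [funext_iff]).trans
      (Equiv.subtypePiEquivPi (p := fun _ x ↦ x * x = x))
  simp [Nat.card_congr e, Nat.card_fun]

/-- If `R` is a finite commutative halidon ring with index `m` and `G` is a cyclic
group of order `m`, then the group ring `RG` has `|E(R)|^m` idempotent elements,
where `E(-)` denotes the set of idempotents. -/
theorem card_idempotents_groupRing {R G : Type*} [CommRing R] [Fintype R] [Group G]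
    [Fintype G] (m : ℕ) (hm : 0 < m) (hR : IsHalidonRing R m)
    (hG : IsCyclic G) (hcard : Fintype.card G = m) :
    Nat.card {x : MonoidAlgebra R G // x * x = x} = Nat.card {x : R // x * x = x} ^ m := by
  subst hcard
  obtain ⟨hunit, ω, hω⟩ := hR
  obtain ⟨χ, hχ⟩ := hω.exists_character (G := G)
  let e : MonoidAlgebra R G ≃ (Fin (Fintype.card G) → R) :=
    MonoidAlgebra.coeffEquiv.trans <| Finsupp.equivFunOnFinite.trans <|
      (Fintype.equivFin G).arrowCongr (Equiv.refl R)
  have : Finite (MonoidAlgebra R G) := Finite.of_equiv _ e.symm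
  have hinj := MonoidAlgebra.fourier_injective _ hunit χ hχ
  have hbij : Function.Bijective (MonoidAlgebra.fourier (Fintype.card G) χ) :=
    (Nat.bijective_iff_injective_and_card _).mpr ⟨hinj, Nat.card_congr e⟩
  rw [← Nat.card_idempotents_pi]
  refine Nat.card_congr ((Equiv.ofBijective _ hbij).subtypeEquiv fun x ↦ ?_)
  rw [Equiv.ofBijective_apply, ← map_mul, hinj.eq_iff]
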